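/- For every integer n ≥ 4 there exist an integer M ≥ (n/24)^{n/6} and permutations π_0, π_1, …, π_M ∈ S_n with π_0 = id such that each π_i is a composition of at most n/2 transpositions with pairwise disjoint supports, and for every pair of distinct indices i, j ∈ {0,…,M}, (1/n)·#{k ∈ {1,…,n} : π_i(k) ≠ π_j(k)} ≥ 3/8. -/

import Mathlib

open Equiv Finset

/-- Permutations agreeing with `c` on `T` are counted by permutations of the complement of `T`. -/
lemma card_perm_agreeing_on {α : Type*} [Fintype α] [DecidableEq α] (c : Perm α) (T : Finset α) :
    #{σ : Perm α | ∀ i ∈ T, σ i = c i} = (Fintype.card α - #T).factorial := by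
  have h₁ : #{σ : Perm α | ∀ i ∈ T, σ i = c i} = #{ρ : Perm α | ∀ i, ¬ i ∉ T → ρ i = i} := by
    refine Finset.card_bij' (fun σ _ => c⁻¹ * σ) (fun ρ _ => c * ρ) ?_ ?_ ?_ ?_
    · intro σ hσ
      simp only [mem_filter, mem_univ, true_and, not_not] at hσ ⊢
      intro i hi
      simp [hσ i hi]
    · intro ρ hρ
      simp only [mem_filter, mem_univ, true_and, not_not] at hρ ⊢
      intro i hi
      simp [hρ i hi]
    · simp
    · simp
  rw [h₁, ← Fintype.card_subtype,
    ← Fintype.card_congr (Perm.subtypeEquivSubtypePerm fun i => i ∉ T), Fintype.card_perm]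
  congr 1
  simp [Fintype.card_subtype, Finset.filter_not, Finset.card_sdiff]

/-- A Gilbert–Varshamov bound: there are `t!` permutations any two of which agree in fewer than
`t` points. -/
lemma exists_permutation_code {α : Type*} [Fintype α] [DecidableEq α] {t : ℕ}
    (ht : t ≤ Fintype.card α) :
    ∃ C : Finset (Perm α), t.factorial ≤ #C ∧
      ∀ σ ∈ C, ∀ τ ∈ C, σ ≠ τ → #{i | σ i = τ i} < t := by
  obtain ⟨C, hC⟩ := Set.Finite.exists_maximal
    (Set.toFinite {C : Finset (Perm α) | ∀ σ ∈ C, ∀ τ ∈ C, σ ≠ τ → #{i | σ i = τ i} < t})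
    ⟨∅, by simp⟩
  refine ⟨C, ?_, hC.prop⟩
  have cover : ∀ σ : Perm α, ∃ c ∈ C, t ≤ #{i | σ i = c i} := by
    intro σ
    by_contra! h
    have hσ : σ ∈ C := by
      refine hC.le_of_ge (y := insert σ C) ?_ (Finset.subset_insert _ _)
        (Finset.mem_insert_self _ _)
      intro ρ hρ τ hτ hne
      rw [Finset.mem_insert] at hρ hτ
      rcases hρ with rfl | hρ <;> rcases hτ with rfl | hτ
      · exact absurd rfl hne
      · exact h τ hτ
      · simpa only [eq_comm] using h ρ hρ
      · exact hC.prop ρ hρ τ hτ hne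
    have := h σ hσ
    simp only [Finset.filter_true, Finset.card_univ] at this
    omega
  have hsub : (univ : Finset (Perm α)) ⊆ (C ×ˢ powersetCard t univ).biUnion
      fun p => {σ : Perm α | ∀ i ∈ p.2, σ i = p.1 i} := by
    intro σ _
    obtain ⟨c, hc, hct⟩ := cover σ
    obtain ⟨T, hT, hTt⟩ := Finset.exists_subset_card_eq hct
    simp only [mem_biUnion, mem_product, mem_powersetCard, mem_filter, mem_univ, true_and]
    exact ⟨(c, T), ⟨hc, subset_univ _, hTt⟩, fun i hi => (mem_filter.1 (hT hi)).2⟩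
  have hcard := (card_le_card hsub).trans (card_biUnion_le_card_mul _ _
    (Fintype.card α - t).factorial fun p hp => by
      simp only [mem_product, mem_powersetCard] at hp
      rw [card_perm_agreeing_on, hp.2.2])
  rw [card_univ, Fintype.card_perm, card_product, card_powersetCard, card_univ,
    ← Nat.choose_mul_factorial_mul_factorial ht] at hcard
  have hpos : 0 < (Fintype.card α).choose t * (Fintype.card α - t).factorial :=
    Nat.mul_pos (Nat.choose_pos ht) (Nat.factorial_pos _)
  refine Nat.le_of_mul_le_mul_left ?_ hpos
  linarith

section Matching

variable {α : Type*} [DecidableEq α] {m : ℕ}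

/-- The transpositions exchanging `f (inl i)` with `f (inr (σ i))`. -/
def matchingSwaps (f : Fin m ⊕ Fin m ↪ α) (σ : Perm (Fin m)) : List (Perm α) :=
  List.ofFn fun i => swap (f (.inl i)) (f (.inr (σ i)))

variable (f : Fin m ⊕ Fin m ↪ α) (σ τ : Perm (Fin m))

lemma isSwap_of_mem_matchingSwaps {ρ : Perm α} (hρ : ρ ∈ matchingSwaps f σ) : ρ.IsSwap := by
  obtain ⟨i, rfl⟩ := (List.mem_ofFn' _ _).1 hρ
  exact ⟨_, _, by simp, rfl⟩

lemma pairwise_disjoint_matchingSwaps : (matchingSwaps f σ).Pairwise Perm.Disjoint := by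
  refine List.pairwise_ofFn.2 fun i j hij => ?_
  refine Perm.disjoint_swap_swap ?_
  simp [hij.ne]

variable [Fintype α]

lemma matchingSwaps_prod_apply {x : α} {i : Fin m}
    (hx : swap (f (.inl i)) (f (.inr (σ i))) x ≠ x) :
    (matchingSwaps f σ).prod x = swap (f (.inl i)) (f (.inr (σ i))) x :=
  (Perm.eq_on_support_mem_disjoint ((List.mem_ofFn' _ _).2 ⟨i, rfl⟩)
    (pairwise_disjoint_matchingSwaps f σ) x (Perm.mem_support.2 hx)).symm

lemma matchingSwaps_prod_inl (i : Fin m) :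
    (matchingSwaps f σ).prod (f (.inl i)) = f (.inr (σ i)) := by
  rw [matchingSwaps_prod_apply f σ (i := i)] <;> simp

lemma matchingSwaps_prod_inr (j : Fin m) :
    (matchingSwaps f σ).prod (f (.inr j)) = f (.inl (σ⁻¹ j)) := by
  rw [matchingSwaps_prod_apply f σ (i := σ⁻¹ j)] <;> simp

lemma two_mul_le_card_matchingSwaps_prod_ne_one :
    2 * m ≤ #{k | (matchingSwaps f σ).prod k ≠ k} := by
  have : #((univ : Finset (Fin m ⊕ Fin m)).map f) = 2 * m := by
    simp [two_mul]
  rw [← this]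
  refine card_le_card fun k hk => ?_
  obtain ⟨i | j, -, rfl⟩ := mem_map.1 hk
  · simp [matchingSwaps_prod_inl]
  · simp [matchingSwaps_prod_inr]

lemma two_mul_card_ne_le_card_matchingSwaps_prod_ne :
    2 * #{i | σ i ≠ τ i} ≤
      #{k | (matchingSwaps f σ).prod k ≠ (matchingSwaps f τ).prod k} := by
  have : #((({i | σ i ≠ τ i} : Finset (Fin m)).disjSum
      (({i | σ i ≠ τ i} : Finset (Fin m)).map σ.toEmbedding)).map f) =
      2 * #{i | σ i ≠ τ i} := by
    rw [card_map, card_disjSum, card_map, two_mul]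
  rw [← this]
  refine card_le_card fun k hk => ?_
  obtain ⟨i | j, hi, rfl⟩ := mem_map.1 hk
  · simpa [matchingSwaps_prod_inl] using hi
  · obtain ⟨i, hi, rfl⟩ := mem_map.1 (inr_mem_disjSum.1 hi)
    have hi : σ i ≠ τ i := by simpa using hi
    simpa [matchingSwaps_prod_inr, Equiv.eq_symm_apply, eq_comm] using hi

end Matching

lemma rpow_div_le_factorial (n : ℕ) :
    ((n : ℝ) / 24) ^ ((n : ℝ) / 6) ≤ (((n + 3) / 4).factorial : ℝ) := by
  set t := (n + 3) / 4 with ht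
  have htn : (n : ℝ) ≤ 4 * t := by
    have : n ≤ 4 * t := by omega
    exact_mod_cast this
  have hn : (0 : ℝ) ≤ n := n.cast_nonneg
  have hfac : (1 : ℝ) ≤ t.factorial := by exact_mod_cast t.factorial_pos
  rcases le_total ((n : ℝ) / 24) 1 with h | h
  · exact (Real.rpow_le_one (by positivity) h (by positivity)).trans hfac
  calc ((n : ℝ) / 24) ^ ((n : ℝ) / 6) ≤ ((n : ℝ) / 24) ^ (t : ℝ) :=
        Real.rpow_le_rpow_of_exponent_le h (by linarith)
    _ = ((n : ℝ) / 24) ^ t := Real.rpow_natCast _ _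
    _ ≤ ((t : ℝ) / 6) ^ t := by gcongr ?_ ^ t; linarith
    _ = (t : ℝ) ^ t / 6 ^ t := div_pow _ _ _
    _ ≤ t.factorial := by
        have h₁ := Real.pow_div_factorial_le_exp (t : ℝ) t.cast_nonneg t
        have h₂ : Real.exp t ≤ 6 ^ t := by
          rw [← mul_one (t : ℝ), Real.exp_nat_mul]
          gcongr
          linarith [Real.exp_one_lt_d9]
        rw [div_le_iff₀ (by positivity)] at h₁ ⊢
        nlinarith


/-- **Lemma 5 (well-separated products of disjoint transpositions).** For every
`n ≥ 4` there exist `M ≥ (n/24)^{n/6}` and permutations `π_0 = id, π_1, …, π_M ∈ S_n`,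
each a composition of at most `n/2` transpositions with pairwise disjoint supports,
such that any two distinct ones differ in at least `3n/8` positions. -/
theorem exists_separated_transposition_products (n : ℕ) (hn : 4 ≤ n) :
    ∃ (M : ℕ) (π : Fin (M + 1) → Equiv.Perm (Fin n)),
      ((n : ℝ) / 24) ^ ((n : ℝ) / 6) ≤ (M : ℝ) ∧ π 0 = 1 ∧
      (∀ i, ∃ l : List (Equiv.Perm (Fin n)),
        π i = l.prod ∧ 2 * l.length ≤ n ∧ (∀ τ ∈ l, τ.IsSwap) ∧
        l.Pairwise Equiv.Perm.Disjoint) ∧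
      ∀ i j : Fin (M + 1), i ≠ j →
        (3 : ℝ) / 8 ≤
          ((Finset.univ.filter fun k => π i k ≠ π j k).card : ℝ) / n := by
  obtain ⟨C, hcard, hC⟩ := exists_permutation_code (α := Fin (n / 2)) (t := (n + 3) / 4)
    (by rw [Fintype.card_fin]; omega)
  let f : Fin (n / 2) ⊕ Fin (n / 2) ↪ Fin n :=
    finSumFinEquiv.toEmbedding.trans (Fin.castLEEmb (by omega))
  let c : Fin #C → Perm (Fin (n / 2)) := fun i => C.equivFin.symm i
  have hc : Function.Injective c := Subtype.val_injective.comp C.equivFin.symm.injective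
  have hdiv : ∀ d : ℕ, 3 * n ≤ 8 * d → (3 : ℝ) / 8 ≤ (d : ℝ) / n := by
    intro d hd
    have hd : (3 * n : ℝ) ≤ 8 * d := by exact_mod_cast hd
    rw [div_le_div_iff₀ (by norm_num) (by positivity)]
    linarith
  have hone : ∀ σ, 3 * n ≤ 8 * #{k | (matchingSwaps f σ).prod k ≠ k} := fun σ => by
    have := two_mul_le_card_matchingSwaps_prod_ne_one f σ
    omega
  refine ⟨#C, Fin.cons 1 fun i => (matchingSwaps f (c i)).prod,
    (rpow_div_le_factorial n).trans (by exact_mod_cast hcard), rfl, fun i => ?_,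
    fun i j hij => hdiv _ ?_⟩
  · cases i using Fin.cases with
    | zero => exact ⟨[], by simp⟩
    | succ i =>
      refine ⟨matchingSwaps f (c i), by simp, ?_, fun _ => isSwap_of_mem_matchingSwaps f _,
        pairwise_disjoint_matchingSwaps f _⟩
      rw [matchingSwaps, List.length_ofFn]
      omega
  · cases i using Fin.cases with
    | zero =>
      cases j using Fin.cases with
      | zero => exact absurd rfl hij
      | succ j => simpa [eq_comm] using hone (c j)
    | succ i =>
      cases j using Fin.cases with
      | zero => simpa using hone (c i)
      | succ j =>
        have hagree := hC (c i) (C.equivFin.symm i).2 (c j) (C.equivFin.symm j).2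
          (hc.ne fun h => hij (congrArg Fin.succ h))
        have hsum := Finset.card_filter_add_card_filter_not (s := univ) (fun k => c i k = c j k)
        have hdist := two_mul_card_ne_le_card_matchingSwaps_prod_ne f (c i) (c j)
        rw [card_univ, Fintype.card_fin] at hsum
        simp only [Fin.cons_succ]
        simp only [ne_eq] at hdist ⊢
        omega
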